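/- Let k ≥ 2 be an integer, N ≥ 1 an integer, and α > 0 real. Then for every ε > 0 there is a constant C(k, ε) such that |∑_{N < n ≤ 2N} ψ(n^k α)| ≤ C(k,ε)·(N·max(α, 1/α))^ε · (N·α^{2^{1−k}} + N^{1−2^{1−k}} + N^{1−k·2^{1−k}}·α^{−2^{1−k}}). -/

import Mathlib

open Finset

noncomputable def psi (x : ℝ) : ℝ := x - ⌊x⌋ - 1/2


theorem exists_card_divisors_le_mul_rpow {η : ℝ} (hη : 0 < η) :
    ∃ C : ℝ, 1 ≤ C ∧ ∀ n : ℕ, n ≠ 0 → (#n.divisors : ℝ) ≤ C * (n : ℝ) ^ η := by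
  obtain ⟨B, hB⟩ := exists_nat_gt ((2 : ℝ) ^ (1 / η))
  obtain ⟨c, hc1, hc⟩ : ∃ c : ℝ, 1 ≤ c ∧ ∀ a : ℕ, (a : ℝ) + 1 ≤ c * ((2 : ℝ) ^ η) ^ a := by
    set s : ℝ := (2 : ℝ) ^ η - 1 with hs
    have hs0 : 0 < s := by
      have := Real.one_lt_rpow (x := 2) (by norm_num) hη
      linarith
    refine ⟨1 + 1 / s, by simp [hs0.le], fun a => ?_⟩
    have h1 : 1 + (a : ℝ) * s ≤ ((2 : ℝ) ^ η) ^ a := by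
      have := one_add_mul_le_pow (a := s) (by linarith) a
      simpa [hs] using this
    calc (a : ℝ) + 1 ≤ (1 + 1 / s) * (1 + a * s) := by
          have : (1 + 1 / s) * (1 + a * s) = 1 + a * s + 1 / s + a := by field_simp; ring
          rw [this]
          have : 0 ≤ a * s := by positivity
          have : 0 ≤ 1 / s := by positivity
          linarith
      _ ≤ _ := by gcongr
  refine ⟨c ^ B, one_le_pow₀ hc1, fun n hn => ?_⟩
  have key : ∀ p ∈ n.primeFactors, ((n.factorization p : ℝ) + 1) ≤
      (if p < B then c else 1) * ((p : ℝ) ^ η) ^ n.factorization p := by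
    intro p hp
    have hp2 : (2 : ℝ) ≤ p := by exact_mod_cast (Nat.prime_of_mem_primeFactors hp).two_le
    split_ifs with h
    · refine (hc _).trans ?_
      gcongr
    · have hpB : (2 : ℝ) ^ (1 / η) ≤ p := hB.le.trans (by exact_mod_cast not_lt.mp h)
      have : (2 : ℝ) ≤ (p : ℝ) ^ η := by
        calc (2 : ℝ) = ((2 : ℝ) ^ (1 / η)) ^ η := by
              rw [← Real.rpow_mul (by norm_num), one_div_mul_cancel hη.ne', Real.rpow_one]
          _ ≤ _ := by gcongr
      rw [one_mul]
      calc (n.factorization p : ℝ) + 1 ≤ 2 ^ n.factorization p := by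
            exact_mod_cast Nat.lt_two_pow_self
        _ ≤ _ := by gcongr
  rw [Nat.card_divisors hn]
  push_cast
  refine (prod_le_prod (fun _ _ => by positivity) key).trans ?_
  rw [prod_mul_distrib]
  gcongr
  · rw [prod_ite, prod_const, prod_const_one, mul_one]
    refine pow_le_pow_right₀ hc1 ?_
    refine (card_le_card (t := range B) fun p hp => ?_).trans (card_range B).le
    simpa using (mem_filter.mp hp).2
  · apply le_of_eq
    conv_rhs => rw [← Nat.prod_factorization_pow_eq_self hn]
    rw [Finsupp.prod]
    push_cast
    rw [← Real.finsetProd_rpow _ _ (fun _ _ => by positivity)]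
    refine prod_congr rfl fun p _ => ?_
    rw [← Real.rpow_natCast, ← Real.rpow_natCast, ← Real.rpow_mul (by positivity),
      ← Real.rpow_mul (by positivity), mul_comm]

open ComplexConjugate in
theorem sq_norm_sum_range_add (x : ℕ → ℂ) (L : ℕ) :
    ‖∑ n ∈ range L, x n‖ ^ 2 + ∑ n ∈ range L, ‖x n‖ ^ 2
      = 2 * (∑ h ∈ range L, ∑ n ∈ range (L - h), x (n + h) * conj (x n)).re := by
  induction L with
  | zero => simp
  | succ L ih =>
    have h1 : ∑ h ∈ range (L + 1), ∑ n ∈ range (L + 1 - h), x (n + h) * conj (x n)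
        = ∑ h ∈ range L, ∑ n ∈ range (L - h), x (n + h) * conj (x n)
          + x L * conj (∑ n ∈ range (L + 1), x n) := by
      rw [← sum_range_reflect x, map_sum, mul_sum]
      have : ∀ h ∈ range (L + 1), ∑ n ∈ range (L + 1 - h), x (n + h) * conj (x n)
          = ∑ n ∈ range (L - h), x (n + h) * conj (x n) + x L * conj (x (L + 1 - 1 - h)) := by
        intro h hh
        have hh' : h ≤ L := by simpa [Nat.lt_succ_iff] using hh
        rw [show L + 1 - h = (L - h) + 1 by lia, sum_range_succ, Nat.sub_add_cancel hh']
        simp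
      rw [sum_congr rfl this, sum_add_distrib]
      congr 1
      rw [sum_range_succ]
      simp
    rw [h1, Complex.add_re, mul_add, ← ih, sum_range_succ, sum_range_succ, ← Complex.normSq_eq_norm_sq,
      ← Complex.normSq_eq_norm_sq, Complex.normSq_add, map_add, mul_add, Complex.add_re,
      Complex.mul_conj, Complex.ofReal_re, ← Complex.normSq_eq_norm_sq]
    have : (x L * conj (∑ n ∈ range L, x n)).re = ((∑ n ∈ range L, x n) * conj (x L)).re := by
      simp; ring
    rw [this]; ring

open ComplexConjugate in
/-- Weyl differencing, with the shifts running up to any bound for the length. -/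
theorem sq_norm_sum_range_le (x : ℕ → ℂ) {L N : ℕ} (hLN : L ≤ N) :
    ‖∑ n ∈ range L, x n‖ ^ 2
      ≤ 2 * ∑ h ∈ range N, ‖∑ n ∈ range (L - h), x (n + h) * conj (x n)‖ := by
  have h1 := sq_norm_sum_range_add x L
  have h2 : (0 : ℝ) ≤ ∑ n ∈ range L, ‖x n‖ ^ 2 := by positivity
  have h3 := (Complex.re_le_norm _).trans
    (norm_sum_le (range L) fun h => ∑ n ∈ range (L - h), x (n + h) * conj (x n))
  have h4 : ∑ h ∈ range L, ‖∑ n ∈ range (L - h), x (n + h) * conj (x n)‖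
      ≤ ∑ h ∈ range N, ‖∑ n ∈ range (L - h), x (n + h) * conj (x n)‖ :=
    sum_le_sum_of_subset_of_nonneg (range_mono hLN) fun _ _ _ => norm_nonneg _
  linarith

/-- The additive character `x ↦ exp (2πix)`. -/
noncomputable def expTwoPi (x : ℝ) : ℂ := Complex.exp ((2 * Real.pi * x : ℝ) * Complex.I)

theorem norm_expTwoPi (x : ℝ) : ‖expTwoPi x‖ = 1 := Complex.norm_exp_ofReal_mul_I _

theorem expTwoPi_add (x y : ℝ) : expTwoPi (x + y) = expTwoPi x * expTwoPi y := by
  simp only [expTwoPi, ← Complex.exp_add]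
  congr 1
  push_cast
  ring

open ComplexConjugate in
theorem expTwoPi_sub (x y : ℝ) : expTwoPi (x - y) = expTwoPi x * conj (expTwoPi y) := by
  simp only [expTwoPi, ← Complex.exp_add, ← Complex.exp_conj, map_mul, Complex.conj_ofReal,
    Complex.conj_I]
  congr 1
  push_cast
  ring

theorem expTwoPi_nat_mul (x : ℝ) (n : ℕ) : expTwoPi (x * n) = expTwoPi x ^ n := by
  simp only [expTwoPi, ← Complex.exp_nat_mul]
  congr 1
  push_cast
  ring

/-- A truncated reciprocal of the distance to the nearest integer: `min N (1 / ‖x‖)`. -/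
noncomputable def invDist (N : ℕ) (x : ℝ) : ℝ := (max (1 / (N : ℝ)) |x - round x|)⁻¹

theorem invDist_nonneg (N : ℕ) (x : ℝ) : 0 ≤ invDist N x := by
  unfold invDist
  positivity

theorem invDist_le {N : ℕ} (hN : 1 ≤ N) (x : ℝ) : invDist N x ≤ N := by
  unfold invDist
  have : (0 : ℝ) < N := by exact_mod_cast hN
  rw [inv_le_comm₀ (by positivity) this]
  simp

theorem abs_sub_round_le_norm_expTwoPi_sub_one (x : ℝ) :
    2 * |x - round x| ≤ ‖expTwoPi x - 1‖ := by
  have h1 : expTwoPi x = Complex.exp (Complex.I * (2 * Real.pi * x : ℝ)) := by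
    rw [expTwoPi, mul_comm]
  rw [h1, Complex.norm_exp_I_mul_ofReal_sub_one, Real.norm_eq_abs, abs_mul, abs_two]
  have h2 : |Real.sin (2 * Real.pi * x / 2)| = |Real.sin (Real.pi * (x - round x))| := by
    have : Real.pi * (x - round x) = 2 * Real.pi * x / 2 - (round x : ℤ) * Real.pi := by ring
    rw [this, Real.sin_sub_int_mul_pi, abs_mul, abs_neg_one_zpow, one_mul]
  rw [h2]
  have h3 : |Real.pi * (x - round x)| ≤ Real.pi / 2 := by
    rw [abs_mul, abs_of_pos Real.pi_pos]
    nlinarith [abs_sub_round x, Real.pi_pos]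
  have h4 := Real.mul_abs_le_abs_sin h3
  rw [abs_mul, abs_of_pos Real.pi_pos, ← mul_assoc, div_mul_cancel₀ _ Real.pi_ne_zero] at h4
  have := abs_nonneg (x - round x)
  linarith

theorem norm_sum_expTwoPi_linear_le {N L : ℕ} (hN : 1 ≤ N) (hLN : L ≤ N) (β γ : ℝ) :
    ‖∑ n ∈ range L, expTwoPi (β * n + γ)‖ ≤ invDist N β := by
  have hN0 : (0 : ℝ) < N := by exact_mod_cast hN
  simp_rw [expTwoPi_add, expTwoPi_nat_mul, ← sum_mul]
  rw [norm_mul, norm_expTwoPi, mul_one, invDist, ← one_div, le_div_iff₀ (by positivity),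
    mul_max_of_nonneg _ _ (norm_nonneg _)]
  refine max_le ?_ ?_
  · rw [mul_one_div, div_le_one hN0]
    refine (norm_sum_le _ _).trans ?_
    simpa [norm_expTwoPi] using hLN
  · have h1 : ‖∑ n ∈ range L, expTwoPi β ^ n‖ * ‖expTwoPi β - 1‖ ≤ 2 := by
      rw [← norm_mul, geom_sum_mul]
      refine (norm_sub_le _ _).trans ?_
      rw [norm_pow, norm_expTwoPi]
      norm_num
    have h2 := mul_le_mul_of_nonneg_left (abs_sub_round_le_norm_expTwoPi_sub_one β)
      (norm_nonneg (∑ n ∈ range L, expTwoPi β ^ n))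
    linarith

/-- The sum over shifts produced by differencing a degree `j + 1` polynomial phase with leading
coefficient `β` down to degree one. -/
noncomputable def weylSum (N : ℕ) : ℕ → ℝ → ℝ
  | 0, β => invDist N β
  | j + 1, β => ∑ h ∈ range N, weylSum N j ((j + 2) * h * β)

open Polynomial in
theorem natDegree_taylor_sub_self_le {f : ℝ[X]} {j : ℕ} (hf : f.natDegree ≤ j + 1) (h : ℝ) :
    (taylor h f - f).natDegree ≤ j := by
  rw [natDegree_le_iff_coeff_eq_zero]
  intro n hn
  rw [coeff_sub, taylor_coeff, sub_eq_zero]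
  have h1 : (hasseDeriv n f).natDegree ≤ 0 := (natDegree_hasseDeriv_le f n).trans (by lia)
  rw [eq_C_of_natDegree_le_zero h1]
  simp [hasseDeriv_coeff]

open Polynomial in
theorem coeff_taylor_sub_self {f : ℝ[X]} {j : ℕ} (hf : f.natDegree ≤ j + 1) (h : ℝ) :
    (taylor h f - f).coeff j = (j + 1) * h * f.coeff (j + 1) := by
  rw [coeff_sub, taylor_coeff]
  have h1 : (hasseDeriv j f).natDegree ≤ 1 := (natDegree_hasseDeriv_le f j).trans (by lia)
  rw [eq_X_add_C_of_natDegree_le_one h1]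
  simp [hasseDeriv_coeff, add_comm 1 j]
  ring

open Polynomial ComplexConjugate in
/-- Weyl's inequality for polynomial phases, before any Diophantine input. -/
theorem norm_sum_expTwoPi_eval_pow_le {N : ℕ} (hN : 1 ≤ N) (j : ℕ) :
    ∀ (f : ℝ[X]) (L : ℕ), f.natDegree ≤ j + 1 → L ≤ N →
      ‖∑ n ∈ range L, expTwoPi (f.eval (n : ℝ))‖ ^ 2 ^ j
        ≤ 2 ^ 2 ^ j * (N : ℝ) ^ (2 ^ j - j - 1) * weylSum N j (f.coeff (j + 1)) := by
  induction j with
  | zero =>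
    intro f L hf hL
    have h1 : ∀ n : ℕ, f.eval (n : ℝ) = f.coeff 1 * n + f.coeff 0 := by
      intro n
      conv_lhs => rw [eq_X_add_C_of_natDegree_le_one hf]
      simp
    simp_rw [h1]
    have h2 := norm_sum_expTwoPi_linear_le hN hL (f.coeff 1) (f.coeff 0)
    have h3 := invDist_nonneg N (f.coeff 1)
    simp only [pow_zero, pow_one, weylSum, zero_add, Nat.sub_zero, Nat.sub_self, mul_one]
    linarith
  | succ j ih =>
    intro f L hf hL
    have hstep : ∀ h ∈ range N, ‖∑ n ∈ range (L - h),
        expTwoPi (f.eval ((n + h : ℕ) : ℝ)) * conj (expTwoPi (f.eval (n : ℝ)))‖ ^ 2 ^ j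
        ≤ 2 ^ 2 ^ j * (N : ℝ) ^ (2 ^ j - j - 1)
          * weylSum N j ((j + 2) * h * f.coeff (j + 1 + 1)) := by
      intro h _
      have h1 := ih (taylor (h : ℝ) f - f) (L - h) (natDegree_taylor_sub_self_le hf _) (by lia)
      rw [coeff_taylor_sub_self hf] at h1
      simp_rw [eval_sub, taylor_eval, expTwoPi_sub] at h1
      push_cast at h1 ⊢
      convert! h1 using 3
      ring
    have hexp : 2 ^ j - 1 + (2 ^ j - j - 1) = 2 ^ (j + 1) - (j + 1) - 1 := by
      have := Nat.lt_two_pow_self (n := j)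
      rw [pow_succ]
      lia
    calc ‖∑ n ∈ range L, expTwoPi (f.eval (n : ℝ))‖ ^ 2 ^ (j + 1)
        = (‖∑ n ∈ range L, expTwoPi (f.eval (n : ℝ))‖ ^ 2) ^ 2 ^ j := by
          rw [← pow_mul, pow_succ, mul_comm]
      _ ≤ (2 * ∑ h ∈ range N, ‖∑ n ∈ range (L - h),
            expTwoPi (f.eval ((n + h : ℕ) : ℝ)) * conj (expTwoPi (f.eval (n : ℝ)))‖) ^ 2 ^ j := by
          gcongr
          exact sq_norm_sum_range_le (fun n => expTwoPi (f.eval (n : ℝ))) hL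
      _ ≤ 2 ^ 2 ^ j * ((N : ℝ) ^ (2 ^ j - 1) * ∑ h ∈ range N,
            2 ^ 2 ^ j * (N : ℝ) ^ (2 ^ j - j - 1)
              * weylSum N j ((j + 2) * h * f.coeff (j + 1 + 1))) := by
          rw [mul_pow]
          gcongr
          obtain ⟨m, hm⟩ : ∃ m, 2 ^ j = m + 1 := ⟨2 ^ j - 1, by have := Nat.one_le_two_pow (n := j); lia⟩
          have h2 := pow_sum_le_card_mul_sum_pow (s := range N) (f := fun h => ‖∑ n ∈ range (L - h),
            expTwoPi (f.eval ((n + h : ℕ) : ℝ)) * conj (expTwoPi (f.eval (n : ℝ)))‖)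
            (fun _ _ => norm_nonneg _) m
          rw [card_range, ← hm] at h2
          refine h2.trans ?_
          rw [show 2 ^ j - 1 = m by lia]
          gcongr with h hh
          exact hstep h hh
      _ = _ := by
          rw [← mul_sum, weylSum, ← hexp, pow_add (N : ℝ), show 2 ^ (j + 1) = 2 ^ j + 2 ^ j by ring, pow_add (2 : ℝ)]
          ring

theorem weylSum_nonneg (N j : ℕ) : ∀ β, 0 ≤ weylSum N j β := by
  induction j with
  | zero => exact invDist_nonneg N
  | succ j ih => exact fun β => sum_nonneg fun h _ => ih _

theorem weylSum_zero_le {N : ℕ} (hN : 1 ≤ N) (j : ℕ) : weylSum N j 0 ≤ (N : ℝ) ^ (j + 1) := by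
  induction j with
  | zero => simpa [weylSum] using invDist_le hN 0
  | succ j ih =>
    simp only [weylSum, mul_zero, sum_const, card_range, nsmul_eq_mul]
    rw [pow_succ' (N : ℝ) (j + 1)]
    gcongr

/-- Sums over products are controlled by the divisor function. -/
theorem sum_sum_mul_le {F : ℕ → ℝ} (hF : ∀ l, 0 ≤ F l) {c H M : ℕ} (hc : 0 < c) {Δ : ℝ}
    (hΔ : ∀ l ∈ Ioc 0 (c * H * M), (#l.divisors : ℝ) ≤ Δ) :
    ∑ h ∈ Ioc 0 H, ∑ m ∈ Ioc 0 M, F (c * h * m) ≤ Δ * ∑ l ∈ Ioc 0 (c * H * M), F l := by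
  rw [← sum_product', mul_sum]
  have hmaps : ∀ p ∈ Ioc 0 H ×ˢ Ioc 0 M, c * p.1 * p.2 ∈ Ioc 0 (c * H * M) := by
    intro p hp
    simp only [mem_product, mem_Ioc] at hp ⊢
    obtain ⟨⟨h1, h2⟩, h3, h4⟩ := hp
    exact ⟨by positivity, by gcongr⟩
  rw [← sum_fiberwise_of_maps_to hmaps]
  refine sum_le_sum fun l hl => ?_
  have h1 : ∀ p ∈ (Ioc 0 H ×ˢ Ioc 0 M).filter (fun p => c * p.1 * p.2 = l),
      F (c * p.1 * p.2) = F l := fun p hp => by rw [(mem_filter.mp hp).2]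
  rw [sum_congr rfl h1, sum_const, nsmul_eq_mul]
  refine mul_le_mul_of_nonneg_right ((Nat.cast_le.mpr ?_).trans (hΔ l hl)) (hF l)
  refine card_le_card_of_injOn Prod.fst ?_ ?_
  · intro p hp
    have hp := (mem_filter.mp hp).2
    have hl0 : l ≠ 0 := (mem_Ioc.mp hl).1.ne'
    simp only [mem_coe, Nat.mem_divisors]
    exact ⟨⟨c * p.2, by rw [← hp]; ring⟩, hl0⟩
  · rintro ⟨h, m⟩ hp ⟨h', m'⟩ hp' (rfl : h = h')
    simp only [coe_filter, mem_product, mem_Ioc, Set.mem_ofPred_eq] at hp hp'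
    have h0 : 0 < c * h := Nat.mul_pos hc hp.1.1.1
    have : m = m' := Nat.eq_of_mul_eq_mul_left h0 (hp.2.trans hp'.2.symm)
    rw [this]

theorem weylSum_le {N : ℕ} (hN : 1 ≤ N) {Δ : ℝ} (hΔ1 : 1 ≤ Δ) (j : ℕ)
    (hΔ : ∀ l ∈ Ioc 0 ((j + 1).factorial * N ^ j), (#l.divisors : ℝ) ≤ Δ) (β : ℝ) :
    weylSum N j β ≤ j * (N : ℝ) ^ j
      + Δ ^ j * ∑ m ∈ Ioc 0 ((j + 1).factorial * N ^ j), invDist N (m * β) := by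
  induction j generalizing β with
  | zero => simp [weylSum]
  | succ j ih =>
    have hdvd : (j + 1).factorial * N ^ j ≤ (j + 1 + 1).factorial * N ^ (j + 1) :=
      Nat.mul_le_mul (Nat.factorial_le (by lia)) (Nat.pow_le_pow_right hN (by lia))
    have hih := ih fun l hl => hΔ l (Ioc_subset_Ioc_right hdvd hl)
    have hsplit : weylSum N (j + 1) β
        ≤ weylSum N j 0 + ∑ h ∈ Ioc 0 N, weylSum N j ((j + 2) * h * β) := by
      rw [weylSum]
      have h1 : range N ⊆ insert 0 (Ioc 0 N) := by
        intro h hh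
        simp only [mem_range, mem_insert, mem_Ioc] at hh ⊢
        lia
      refine (sum_le_sum_of_subset_of_nonneg h1 fun _ _ _ => weylSum_nonneg _ _ _).trans ?_
      rw [sum_insert (by simp)]
      simp
    have hprod := sum_sum_mul_le (F := fun l => invDist N (l * β)) (fun _ => invDist_nonneg _ _)
      (c := j + 2) (H := N) (M := (j + 1).factorial * N ^ j) (by lia) (Δ := Δ) (by
        intro l hl
        refine hΔ l ?_
        convert! hl using 2
        rw [Nat.factorial_succ (j + 1)]
        ring)
    have hM : (j + 2) * N * ((j + 1).factorial * N ^ j) = (j + 1 + 1).factorial * N ^ (j + 1) := by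
      rw [Nat.factorial_succ (j + 1)]
      ring
    rw [hM] at hprod
    calc weylSum N (j + 1) β
        ≤ (N : ℝ) ^ (j + 1) + ∑ h ∈ Ioc 0 N, (j * (N : ℝ) ^ j + Δ ^ j *
            ∑ m ∈ Ioc 0 ((j + 1).factorial * N ^ j), invDist N (m * ((j + 2) * h * β))) := by
          refine hsplit.trans (add_le_add (weylSum_zero_le hN j) (sum_le_sum fun h _ => hih _))
      _ = (j + 1) * (N : ℝ) ^ (j + 1) + Δ ^ j * ∑ h ∈ Ioc 0 N,
            ∑ m ∈ Ioc 0 ((j + 1).factorial * N ^ j), invDist N (((j + 2) * h * m : ℕ) * β) := by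
          rw [sum_add_distrib, sum_const, Nat.card_Ioc, Nat.sub_zero, ← mul_sum, nsmul_eq_mul, pow_succ]
          have : ∀ h m : ℕ, (m : ℝ) * ((j + 2) * h * β) = (((j + 2) * h * m : ℕ) : ℝ) * β := by
            intro h m
            push_cast
            ring
          simp_rw [this]
          ring
      _ ≤ (j + 1) * (N : ℝ) ^ (j + 1) + Δ ^ j * (Δ *
            ∑ l ∈ Ioc 0 ((j + 1 + 1).factorial * N ^ (j + 1)), invDist N (l * β)) := by
          gcongr
      _ = _ := by
          push_cast
          ring

theorem cast_harmonic_eq_sum_Ioc (H : ℕ) : (harmonic H : ℝ) = ∑ h ∈ Ioc 0 H, (h : ℝ)⁻¹ := by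
  rw [harmonic_eq_sum_Icc]
  push_cast
  rfl

theorem cast_harmonic_nonneg (H : ℕ) : (0 : ℝ) ≤ harmonic H := by
  rw [cast_harmonic_eq_sum_Ioc]
  positivity

theorem sum_invDist_le_of_injOn {N : ℕ} (hN : 1 ≤ N) {α : ℝ} (hα : 0 < α) {s : Finset ℕ} {φ : ℕ → ℕ}
    (hφ : Set.InjOn φ s) {m : ℕ} (hm : ∀ l ∈ s, φ l ≤ m)
    (h : ∀ l ∈ s, φ l * α ≤ |l * α - round (l * α)|) :
    ∑ l ∈ s, invDist N (l * α) ≤ N + α⁻¹ * harmonic m := by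
  set v : ℕ → ℝ := fun i => if i = 0 then (N : ℝ) else α⁻¹ * (i : ℝ)⁻¹ with hv
  have hv0 : ∀ i, 0 ≤ v i := by
    intro i
    simp only [hv]
    split_ifs <;> positivity
  have h1 : ∀ l ∈ s, invDist N (l * α) ≤ v (φ l) := by
    intro l hl
    simp only [hv]
    split_ifs with h0
    · exact invDist_le hN _
    · have : (0 : ℝ) < φ l := by exact_mod_cast Nat.pos_of_ne_zero h0
      rw [← mul_inv, mul_comm α, invDist]
      gcongr
      exact (h l hl).trans (le_max_right _ _)
  calc ∑ l ∈ s, invDist N (l * α) ≤ ∑ l ∈ s, v (φ l) := sum_le_sum h1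
    _ = ∑ i ∈ s.image φ, v i := (sum_image hφ).symm
    _ ≤ ∑ i ∈ range (m + 1), v i := by
        refine sum_le_sum_of_subset_of_nonneg ?_ fun i _ _ => hv0 i
        intro i hi
        obtain ⟨l, hl, rfl⟩ := mem_image.mp hi
        exact mem_range.mpr (Nat.lt_succ_of_le (hm l hl))
    _ = N + α⁻¹ * harmonic m := by
        rw [sum_range_succ', harmonic]
        simp only [hv]
        push_cast
        rw [mul_sum, add_comm]

theorem sum_invDist_le_of_round_eq {N : ℕ} (hN : 1 ≤ N) {α : ℝ} (hα : 0 < α) {s : Finset ℕ} {r : ℤ}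
    (hr : ∀ l ∈ s, round ((l : ℝ) * α) = r) :
    ∑ l ∈ s, invDist N (l * α) ≤ 2 * (N + α⁻¹ * harmonic ⌊α⁻¹⌋₊) := by
  have habs : ∀ l ∈ s, |(l : ℝ) - r / α| * α = |(l : ℝ) * α - round ((l : ℝ) * α)| := by
    intro l hl
    rw [hr l hl]
    nth_rw 2 [← abs_of_pos hα]
    rw [← abs_mul]
    congr 1
    field_simp
  have hm : ∀ l ∈ s, ⌊|(l : ℝ) - r / α|⌋₊ ≤ ⌊α⁻¹⌋₊ := by
    intro l hl
    refine Nat.floor_mono ?_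
    rw [← one_div, le_div_iff₀ hα, habs l hl]
    linarith [abs_sub_round ((l : ℝ) * α)]
  have hle : ∀ l ∈ s, (⌊|(l : ℝ) - r / α|⌋₊ : ℝ) * α ≤ |l * α - round (l * α)| := by
    intro l hl
    rw [← habs l hl]
    gcongr
    exact Nat.floor_le (abs_nonneg _)
  have hclose : ∀ x y : ℝ, 0 ≤ x → 0 ≤ y → ⌊x⌋₊ = ⌊y⌋₊ → |x - y| < 1 := by
    intro x y hx hy hxy
    have h1 := Nat.floor_le hx
    have h2 := Nat.lt_floor_add_one x
    have h3 := Nat.floor_le hy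
    have h4 := Nat.lt_floor_add_one y
    rw [hxy] at h1 h2
    rw [abs_lt]
    constructor <;> linarith
  have hnat : ∀ l l' : ℕ, |(l : ℝ) - l'| < 1 → l = l' := by
    intro l l' h
    have : |(l : ℤ) - l'| < 1 := by exact_mod_cast h
    rw [Int.abs_lt_one_iff] at this
    lia
  rw [← sum_filter_add_sum_filter_not s (fun l : ℕ => 0 ≤ (l : ℝ) - r / α), two_mul]
  refine add_le_add (sum_invDist_le_of_injOn hN hα (φ := fun l => ⌊|(l : ℝ) - r / α|⌋₊) ?_
    (fun l hl => hm l (mem_filter.mp hl).1) fun l hl => hle l (mem_filter.mp hl).1)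
    (sum_invDist_le_of_injOn hN hα (φ := fun l => ⌊|(l : ℝ) - r / α|⌋₊) ?_
    (fun l hl => hm l (mem_filter.mp hl).1) fun l hl => hle l (mem_filter.mp hl).1)
  · intro l hl l' hl' heq
    have h1 := hclose _ _ (abs_nonneg _) (abs_nonneg _) heq
    rw [abs_of_nonneg (mem_filter.mp hl).2, abs_of_nonneg (mem_filter.mp hl').2,
      sub_sub_sub_cancel_right] at h1
    exact hnat _ _ h1
  · intro l hl l' hl' heq
    have h1 := hclose _ _ (abs_nonneg _) (abs_nonneg _) heq
    rw [abs_of_neg (not_le.mp (mem_filter.mp hl).2), abs_of_neg (not_le.mp (mem_filter.mp hl').2),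
      neg_sub_neg, sub_sub_sub_cancel_right] at h1
    exact (hnat _ _ h1).symm

theorem sum_invDist_Ioc_le {N : ℕ} (hN : 1 ≤ N) {α : ℝ} (hα : 0 < α) (a M : ℕ) :
    ∑ l ∈ Ioc a (a + M), invDist N (l * α)
      ≤ (M * α + 2) * (2 * (N + α⁻¹ * harmonic ⌊α⁻¹⌋₊)) := by
  have hround : Monotone (round : ℝ → ℤ) := by
    intro x y hxy
    rw [round_eq, round_eq]
    gcongr
  have hmaps : ∀ l ∈ Ioc a (a + M), round ((l : ℝ) * α) ∈
      Icc (round ((a : ℝ) * α)) (round (((a + M : ℕ) : ℝ) * α)) := by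
    intro l hl
    obtain ⟨h1, h2⟩ := mem_Ioc.mp hl
    rw [mem_Icc]
    constructor <;> apply hround <;> gcongr
  rw [← sum_fiberwise_of_maps_to hmaps]
  refine (sum_le_card_nsmul _ _ (2 * (N + α⁻¹ * harmonic ⌊α⁻¹⌋₊)) fun r _ =>
    sum_invDist_le_of_round_eq hN hα fun l hl => (mem_filter.mp hl).2).trans ?_
  rw [nsmul_eq_mul]
  refine mul_le_mul_of_nonneg_right ?_ ?_
  · have hle : round ((a : ℝ) * α) ≤ round (((a + M : ℕ) : ℝ) * α) := by
      apply hround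
      gcongr
      lia
    rw [Int.card_Icc]
    have : ((round (((a + M : ℕ) : ℝ) * α) + 1 - round ((a : ℝ) * α)).toNat : ℝ)
        = round (((a + M : ℕ) : ℝ) * α) + 1 - round ((a : ℝ) * α) := by
      have h := Int.toNat_of_nonneg (a := round (((a + M : ℕ) : ℝ) * α) + 1 - round ((a : ℝ) * α))
        (by lia)
      exact_mod_cast h
    rw [this]
    have h1 := abs_le.mp (abs_sub_round ((a : ℝ) * α))
    have h2 := abs_le.mp (abs_sub_round (((a + M : ℕ) : ℝ) * α))
    push_cast at h2 ⊢
    linarith [h1.1, h1.2, h2.1, h2.2]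
  · have := cast_harmonic_nonneg ⌊α⁻¹⌋₊
    positivity

theorem sum_min_mul_le {g : ℕ → ℝ} (hg : ∀ l, 0 ≤ g l) {M : ℕ} {B : ℝ}
    (hB : ∀ a, ∑ l ∈ Ioc a (a + M), g l ≤ B) (H : ℕ) :
    ∑ l ∈ Ioc 0 (H * M), min 1 ((M : ℝ) / l) * g l ≤ 2 * harmonic H * B := by
  induction H with
  | zero => simp
  | succ H ih =>
    have h1 : ∀ l ∈ Ioc (H * M) (H * M + M), min 1 ((M : ℝ) / l) * g l
        ≤ 2 * ((H + 1 : ℕ) : ℝ)⁻¹ * g l := by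
      intro l hl
      refine mul_le_mul_of_nonneg_right ?_ (hg l)
      have hl0 : (0 : ℝ) < l := by exact_mod_cast (Nat.zero_le _).trans_lt (mem_Ioc.mp hl).1
      rcases Nat.eq_zero_or_pos H with rfl | hH
      · norm_num
      · refine (min_le_right _ _).trans ?_
        rw [← div_eq_mul_inv, div_le_div_iff₀ hl0 (by positivity)]
        have h2 : (H : ℝ) * M ≤ l := by exact_mod_cast (mem_Ioc.mp hl).1.le
        have h3 : (1 : ℝ) ≤ H := by exact_mod_cast hH
        push_cast
        nlinarith [Nat.cast_nonneg (α := ℝ) M]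
    rw [Nat.succ_mul, ← sum_Ioc_consecutive _ (Nat.zero_le (H * M)) (Nat.le_add_right _ _),
      harmonic_succ]
    push_cast at h1 ⊢
    have h4 := sum_le_sum h1
    rw [← mul_sum] at h4
    have h5 : 2 * ((H : ℝ) + 1)⁻¹ * ∑ l ∈ Ioc (H * M) (H * M + M), g l ≤ 2 * ((H : ℝ) + 1)⁻¹ * B := by
      gcongr
      exact hB _
    linarith

theorem psi_eq_fract (x : ℝ) : psi x = Int.fract x - 1 / 2 := by
  rw [psi, Int.fract]

theorem bernoulliFun_fract_add_sub_le {δ : ℝ} (hδ : 0 ≤ δ) (hδ1 : δ ≤ 1) (x : ℝ) :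
    bernoulliFun 2 (Int.fract (x + δ)) - bernoulliFun 2 (Int.fract x)
      ≤ 2 * δ * psi x + δ ^ 2 := by
  have h0 := Int.fract_nonneg x
  have h1 := Int.fract_lt_one x
  rw [bernoulliFun_two, bernoulliFun_two, psi_eq_fract]
  rcases lt_or_ge (Int.fract x + δ) 1 with h | h
  · have : Int.fract (x + δ) = Int.fract x + δ := by
      rw [Int.fract_eq_iff]
      exact ⟨by positivity, h, ⌊x⌋, by rw [Int.fract]; ring⟩
    rw [this]
    nlinarith
  · have : Int.fract (x + δ) = Int.fract x + δ - 1 := by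
      rw [Int.fract_eq_iff]
      exact ⟨by linarith, by linarith, ⌊x⌋ + 1, by rw [Int.fract]; push_cast; ring⟩
    rw [this]
    nlinarith

theorem le_bernoulliFun_fract_sub {δ : ℝ} (hδ : 0 ≤ δ) (hδ1 : δ ≤ 1) (x : ℝ) :
    2 * δ * psi x - δ ^ 2
      ≤ bernoulliFun 2 (Int.fract x) - bernoulliFun 2 (Int.fract (x + -δ)) := by
  have h0 := Int.fract_nonneg x
  have h1 := Int.fract_lt_one x
  rw [bernoulliFun_two, bernoulliFun_two, psi_eq_fract]
  rcases le_or_gt δ (Int.fract x) with h | h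
  · have : Int.fract (x + -δ) = Int.fract x - δ := by
      rw [Int.fract_eq_iff]
      exact ⟨by linarith, by linarith, ⌊x⌋, by rw [Int.fract]; ring⟩
    rw [this]
    nlinarith
  · have : Int.fract (x + -δ) = Int.fract x - δ + 1 := by
      rw [Int.fract_eq_iff]
      exact ⟨by linarith, by linarith, ⌊x⌋ - 1, by rw [Int.fract]; push_cast; ring⟩
    rw [this]
    nlinarith

theorem hasSum_cos_bernoulliFun_fract (x : ℝ) :
    HasSum (fun m : ℕ => 1 / (m : ℝ) ^ 2 * Real.cos (2 * Real.pi * (m * x)))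
      (Real.pi ^ 2 * bernoulliFun 2 (Int.fract x)) := by
  have h := hasSum_one_div_nat_pow_mul_cos one_ne_zero
    (x := Int.fract x) ⟨Int.fract_nonneg x, (Int.fract_lt_one x).le⟩
  convert! h using 1
  · funext m
    simp only [mul_one]
    congr 1
    rw [← Real.cos_sub_int_mul_two_pi _ (m * ⌊x⌋), Int.fract]
    congr 1
    push_cast
    ring
  · simp only [bernoulliFun, mul_one, Nat.factorial_two]
    push_cast
    ring

theorem norm_expTwoPi_sub_one_le (x : ℝ) : ‖expTwoPi x - 1‖ ≤ 2 * Real.pi * |x| := by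
  rw [expTwoPi, mul_comm]
  refine Real.norm_exp_I_mul_ofReal_sub_one_le.trans ?_
  rw [Real.norm_eq_abs, abs_mul, abs_of_pos Real.two_pi_pos]

theorem expTwoPi_re (x : ℝ) : (expTwoPi x).re = Real.cos (2 * Real.pi * x) :=
  Complex.exp_ofReal_mul_I_re _

theorem abs_sum_bernoulliFun_fract_sub_le {N : ℕ} (hN : 1 ≤ N) {s : Finset ℕ} (hs : #s ≤ N)
    (x : ℕ → ℝ) {η : ℝ} (hη : |η| ≤ 1 / N) :
    N * |∑ n ∈ s, (bernoulliFun 2 (Int.fract (x n + η)) - bernoulliFun 2 (Int.fract (x n)))|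
      ≤ 1 + ∑ h ∈ Ioc 0 (N ^ 2), (h : ℝ)⁻¹ * ‖∑ n ∈ s, expTwoPi (h * x n)‖ := by
  have hN0 : (0 : ℝ) < N := by exact_mod_cast hN
  have hpi := Real.pi_gt_three
  set S : ℕ → ℂ := fun h => ∑ n ∈ s, expTwoPi (h * x n) with hS
  set T : ℝ := ∑ h ∈ Ioc 0 (N ^ 2), (h : ℝ)⁻¹ * ‖S h‖ with hT
  have hT0 : 0 ≤ T := by positivity
  set b : ℕ → ℝ := fun m => ∑ n ∈ s, (1 / (m : ℝ) ^ 2 * Real.cos (2 * Real.pi * (m * (x n + η)))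
    - 1 / (m : ℝ) ^ 2 * Real.cos (2 * Real.pi * (m * x n))) with hb
  have hsum : HasSum b (∑ n ∈ s, (Real.pi ^ 2 * bernoulliFun 2 (Int.fract (x n + η))
      - Real.pi ^ 2 * bernoulliFun 2 (Int.fract (x n)))) :=
    hasSum_sum fun n _ => (hasSum_cos_bernoulliFun_fract _).sub (hasSum_cos_bernoulliFun_fract _)
  have hb1 : ∀ m, |b m| ≤ ((m : ℝ) ^ 2)⁻¹ * (‖S m‖ * ‖expTwoPi (m * η) - 1‖) := by
    intro m
    have : b m = ((m : ℝ) ^ 2)⁻¹ * (S m * (expTwoPi (m * η) - 1)).re := by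
      simp only [hb, hS, ← expTwoPi_re]
      simp only [mul_add, expTwoPi_add]
      rw [mul_sub, mul_one, sum_mul, Complex.sub_re, Complex.re_sum, Complex.re_sum,
        ← sum_sub_distrib, mul_sum]
      exact sum_congr rfl fun n _ => by ring
    rw [this, abs_mul, abs_of_nonneg (by positivity), ← norm_mul]
    gcongr
    exact Complex.abs_re_le_norm _
  have hsmall : ∀ m ∈ Ioc 0 (N ^ 2), |b m| ≤ 2 * Real.pi / N * ((m : ℝ)⁻¹ * ‖S m‖) := by
    intro m hm
    have hm0 : (0 : ℝ) < m := by exact_mod_cast (mem_Ioc.mp hm).1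
    refine (hb1 m).trans ?_
    have h1 := norm_expTwoPi_sub_one_le (m * η)
    rw [abs_mul, abs_of_pos hm0] at h1
    calc ((m : ℝ) ^ 2)⁻¹ * (‖S m‖ * ‖expTwoPi (m * η) - 1‖)
        ≤ ((m : ℝ) ^ 2)⁻¹ * (‖S m‖ * (2 * Real.pi * (m * (1 / N)))) := by
          gcongr
          refine h1.trans ?_
          gcongr
      _ = _ := by field_simp
  have hlarge : ∀ m, |b m| ≤ 2 * N * ((m : ℝ) ^ 2)⁻¹ := by
    intro m
    refine (hb1 m).trans ?_
    have h1 : ‖S m‖ ≤ N := by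
      refine (norm_sum_le _ _).trans ?_
      simpa [norm_expTwoPi] using hs
    have h2 : ‖expTwoPi (m * η) - 1‖ ≤ 2 := by
      refine (norm_sub_le _ _).trans ?_
      rw [norm_expTwoPi]
      norm_num
    calc ((m : ℝ) ^ 2)⁻¹ * (‖S m‖ * ‖expTwoPi (m * η) - 1‖) ≤ ((m : ℝ) ^ 2)⁻¹ * (N * 2) := by
          gcongr
      _ = _ := by ring
  have hpart : ∀ L, |∑ m ∈ range L, b m| ≤ 2 * Real.pi / N * T + 2 / N := by
    intro L
    have hb0 : b 0 = 0 := by simp [hb]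
    have hsub : range L ⊆ insert 0 (Ioc 0 (N ^ 2) ∪ Ioc (N ^ 2) (L + N ^ 2)) := by
      intro m hm
      simp only [mem_range, mem_insert, mem_union, mem_Ioc] at hm ⊢
      lia
    calc |∑ m ∈ range L, b m| ≤ ∑ m ∈ range L, |b m| := abs_sum_le_sum_abs _ _
      _ ≤ ∑ m ∈ insert 0 (Ioc 0 (N ^ 2) ∪ Ioc (N ^ 2) (L + N ^ 2)), |b m| :=
          sum_le_sum_of_subset_of_nonneg hsub fun _ _ _ => abs_nonneg _
      _ = ∑ m ∈ Ioc 0 (N ^ 2), |b m| + ∑ m ∈ Ioc (N ^ 2) (L + N ^ 2), |b m| := by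
          rw [sum_insert (by simp), hb0, abs_zero, zero_add, sum_union]
          rw [disjoint_left]
          intro m h1 h2
          simp only [mem_Ioc] at h1 h2
          lia
      _ ≤ ∑ m ∈ Ioc 0 (N ^ 2), 2 * Real.pi / N * ((m : ℝ)⁻¹ * ‖S m‖)
            + ∑ m ∈ Ioc (N ^ 2) (L + N ^ 2), 2 * N * ((m : ℝ) ^ 2)⁻¹ :=
          add_le_add (sum_le_sum hsmall) (sum_le_sum fun m _ => hlarge m)
      _ ≤ 2 * Real.pi / N * T + 2 * N * ((N ^ 2 : ℕ) : ℝ)⁻¹ := by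
          rw [← mul_sum, ← mul_sum]
          gcongr
          refine (sum_Ioc_inv_sq_le_sub (by positivity) (by lia)).trans ?_
          simp only [sub_le_self_iff]
          positivity
      _ = _ := by
          push_cast
          field_simp
  have hlim := le_of_tendsto hsum.tendsto_sum_nat.abs (Filter.Eventually.of_forall hpart)
  simp_rw [← mul_sub] at hlim
  rw [← mul_sum, abs_mul, abs_of_pos (by positivity)] at hlim
  set A := |∑ n ∈ s, (bernoulliFun 2 (Int.fract (x n + η)) - bernoulliFun 2 (Int.fract (x n)))|
  have h1 : Real.pi ^ 2 * (N * A) ≤ 2 * Real.pi * T + 2 := by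
    calc Real.pi ^ 2 * (N * A) = N * (Real.pi ^ 2 * A) := by ring
      _ ≤ N * (2 * Real.pi / N * T + 2 / N) := by gcongr
      _ = _ := by field_simp
  have h2 : Real.pi ^ 2 * (N * A) ≤ Real.pi ^ 2 * (1 + T) := by nlinarith [mul_nonneg hT0 Real.pi_pos.le]
  exact le_of_mul_le_mul_left h2 (by positivity)

/-- A truncated Fourier bound for sums of the sawtooth function. -/
theorem abs_sum_psi_le {N : ℕ} (hN : 1 ≤ N) {s : Finset ℕ} (hs : #s ≤ N) (x : ℕ → ℝ) :
    |∑ n ∈ s, psi (x n)|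
      ≤ 1 + ∑ h ∈ Ioc 0 (N ^ 2), (h : ℝ)⁻¹ * ‖∑ n ∈ s, expTwoPi (h * x n)‖ := by
  have hN0 : (0 : ℝ) < N := by exact_mod_cast hN
  have hN1 : (1 : ℝ) ≤ N := by exact_mod_cast hN
  have hs' : (#s : ℝ) ≤ N := by exact_mod_cast hs
  set T : ℝ := ∑ h ∈ Ioc 0 (N ^ 2), (h : ℝ)⁻¹ * ‖∑ n ∈ s, expTwoPi (h * x n)‖ with hT
  set δ : ℝ := 1 / N with hδ
  have hδ0 : 0 < δ := by positivity
  have hδ1 : δ ≤ 1 := by rw [hδ, div_le_one hN0]; exact hN1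
  have hNδ : N * δ = 1 := by rw [hδ]; field_simp
  have hup := abs_sum_bernoulliFun_fract_sub_le hN hs x (η := δ) (abs_of_pos hδ0).le
  have hdn := abs_sum_bernoulliFun_fract_sub_le hN hs x (η := -δ) (by rw [abs_neg, abs_of_pos hδ0])
  rw [← hT] at hup hdn
  have h1 := sum_le_sum fun n (_ : n ∈ s) => bernoulliFun_fract_add_sub_le hδ0.le hδ1 (x n)
  have h2 := sum_le_sum fun n (_ : n ∈ s) => le_bernoulliFun_fract_sub hδ0.le hδ1 (x n)
  rw [sum_add_distrib, ← mul_sum, sum_const, nsmul_eq_mul] at h1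
  rw [sum_sub_distrib, ← mul_sum, sum_const, nsmul_eq_mul, sum_sub_distrib] at h2
  rw [sum_sub_distrib] at hup hdn h1
  set P := ∑ n ∈ s, psi (x n)
  have h3 : (#s : ℝ) * δ ^ 2 ≤ δ := by
    calc (#s : ℝ) * δ ^ 2 ≤ N * δ ^ 2 := by gcongr
      _ = δ := by rw [pow_two, ← mul_assoc, hNδ, one_mul]
  have key : ∀ D : ℝ, N * |D| ≤ 1 + T → N * D ≤ 1 + T ∧ -(1 + T) ≤ N * D := by
    intro D hD
    rw [← abs_of_pos hN0, ← abs_mul] at hD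
    exact ⟨(abs_le.mp hD).2, (abs_le.mp hD).1⟩
  have hup' := (key _ hup).2
  have hdn' := (key _ hdn).2
  have hT0 : 0 ≤ T := by positivity
  have e1 := mul_le_mul_of_nonneg_left (h1.trans (add_le_add_right h3 _)) hN0.le
  have e2 := mul_le_mul_of_nonneg_left (sub_le_iff_le_add.mp h2 |>.trans (add_le_add_right h3 _)) hN0.le
  have e3 : (N : ℝ) * (2 * δ * P) = 2 * P := by linear_combination (2 * P) * hNδ
  rw [mul_add, e3, hNδ] at e1
  rw [mul_add, e3, hNδ] at e2
  rw [abs_le]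
  constructor <;> linarith

open Polynomial in
theorem norm_sum_expTwoPi_mul_pow_le {N : ℕ} (hN : 1 ≤ N) (j : ℕ) (β : ℝ) :
    ‖∑ n ∈ Ioc N (2 * N), expTwoPi (β * (n : ℝ) ^ (j + 1))‖ ^ 2 ^ j
      ≤ 2 ^ 2 ^ j * (N : ℝ) ^ (2 ^ j - j - 1) * weylSum N j β := by
  have hdeg : (C β * X ^ (j + 1) : ℝ[X]).natDegree ≤ j + 1 := natDegree_C_mul_X_pow_le _ _
  have h := norm_sum_expTwoPi_eval_pow_le hN j (taylor ((N : ℝ) + 1) (C β * X ^ (j + 1))) N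
    (by rwa [natDegree_taylor]) le_rfl
  have hcoeff : (taylor ((N : ℝ) + 1) (C β * X ^ (j + 1))).coeff (j + 1) = β := by
    rw [taylor_coeff,
      eq_C_of_natDegree_le_zero ((natDegree_hasseDeriv_le _ (j + 1)).trans (by lia))]
    simp [hasseDeriv_coeff]
  have hIoc : Ioc N (2 * N) = Ico (N + 1) (2 * N + 1) := by
    ext n
    simp only [mem_Ioc, mem_Ico]
    lia
  rw [hcoeff] at h
  rw [hIoc, sum_Ico_eq_sum_range, show 2 * N + 1 - (N + 1) = N by lia]
  convert! h using 6 with n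
  simp only [taylor_eval, eval_mul, eval_C, eval_pow, eval_X]
  push_cast
  ring

theorem sum_inv_mul_norm_sum_expTwoPi_pow_le {N j : ℕ} (hN : 1 ≤ N) (hj : 1 ≤ j) {α Y : ℝ}
    (hα : 0 < α) (hY : 1 ≤ Y)
    (hdiv : ∀ l ∈ Ioc 0 (N ^ 2 * ((j + 1).factorial * N ^ j)), (#l.divisors : ℝ) ≤ Y)
    (hN2 : (harmonic (N ^ 2) : ℝ) ≤ Y) (hα2 : (harmonic ⌊α⁻¹⌋₊ : ℝ) ≤ Y) :
    ∑ h ∈ Ioc 0 (N ^ 2), (h : ℝ)⁻¹ *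
        ‖∑ n ∈ Ioc N (2 * N), expTwoPi (h * ((n : ℝ) ^ (j + 1) * α))‖ ^ 2 ^ j
      ≤ 2 ^ 2 ^ j * (j + 16 * (j + 1).factorial) * Y ^ (j + 3) *
        ((N : ℝ) ^ (2 ^ j - j - 1) * ((N : ℝ) ^ (j + 1) * α + (N : ℝ) ^ j + α⁻¹)) := by
  have hN1 : (1 : ℝ) ≤ N := by exact_mod_cast hN
  set M : ℕ := (j + 1).factorial * N ^ j with hM
  set Q : ℝ := (N : ℝ) ^ (j + 1) * α + (N : ℝ) ^ j + α⁻¹ with hQ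
  have hharm := cast_harmonic_nonneg (N ^ 2)
  have hharm' := cast_harmonic_nonneg ⌊α⁻¹⌋₊
  have hNj : (N : ℝ) ≤ (N : ℝ) ^ j := le_self_pow₀ hN1 (by lia)
  have hfac : (1 : ℝ) ≤ (j + 1).factorial := by exact_mod_cast Nat.factorial_pos _
  have hN2pos : M ≤ N ^ 2 * M := Nat.le_mul_of_pos_left _ (by positivity)
  have hblock : ∀ a, ∑ l ∈ Ioc a (a + M), invDist N (l * α)
      ≤ 8 * (j + 1).factorial * Y * Q := by
    intro a
    refine (sum_invDist_Ioc_le hN hα a M).trans ?_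
    calc (M * α + 2) * (2 * (N + α⁻¹ * harmonic ⌊α⁻¹⌋₊))
        ≤ ((j + 1).factorial * (N ^ j * α + 2)) * (2 * (N * Y + α⁻¹ * Y)) := by
          gcongr
          · rw [hM]
            push_cast
            nlinarith
          · exact le_mul_of_one_le_right (by positivity) hY
      _ = 2 * (j + 1).factorial * Y *
            ((N : ℝ) ^ (j + 1) * α + N ^ j * (α * α⁻¹) + 2 * N + 2 * α⁻¹) := by ring
      _ ≤ 2 * (j + 1).factorial * Y * (4 * Q) := by
          gcongr
          rw [mul_inv_cancel₀ hα.ne', hQ]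
          have : 0 ≤ (N : ℝ) ^ (j + 1) * α := by positivity
          have : 0 < α⁻¹ := by positivity
          linarith
      _ = _ := by ring
  have hdouble : ∑ h ∈ Ioc 0 (N ^ 2), (h : ℝ)⁻¹ * ∑ m ∈ Ioc 0 M, invDist N (m * (h * α))
      ≤ 16 * (j + 1).factorial * Y ^ 3 * Q := by
    have h1 := sum_sum_mul_le (F := fun l => min 1 ((M : ℝ) / l) * invDist N (l * α))
      (fun l => mul_nonneg (by positivity) (invDist_nonneg _ _)) (c := 1) (H := N ^ 2) (M := M)
      one_pos (Δ := Y) (by simpa using hdiv)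
    rw [one_mul] at h1
    have h2 := sum_min_mul_le (fun l => invDist_nonneg N (l * α)) hblock (N ^ 2)
    calc ∑ h ∈ Ioc 0 (N ^ 2), (h : ℝ)⁻¹ * ∑ m ∈ Ioc 0 M, invDist N (m * (h * α))
        ≤ ∑ h ∈ Ioc 0 (N ^ 2), ∑ m ∈ Ioc 0 M, min 1 ((M : ℝ) / (1 * h * m : ℕ)) *
            invDist N ((1 * h * m : ℕ) * α) := by
          refine sum_le_sum fun h hh => ?_
          rw [mul_sum]
          refine sum_le_sum fun m hm => ?_
          have hh1 : (1 : ℝ) ≤ h := by exact_mod_cast (mem_Ioc.mp hh).1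
          have hm1 : (0 : ℝ) < m := by exact_mod_cast (mem_Ioc.mp hm).1
          have hmM : (m : ℝ) ≤ M := by exact_mod_cast (mem_Ioc.mp hm).2
          have harg : (m : ℝ) * (h * α) = ((1 * h * m : ℕ) : ℝ) * α := by
            push_cast
            ring
          rw [harg]
          refine mul_le_mul_of_nonneg_right (le_min (inv_le_one_of_one_le₀ hh1) ?_)
            (invDist_nonneg _ _)
          push_cast
          rw [one_mul, inv_eq_one_div, div_le_div_iff₀ (by positivity) (by positivity)]
          nlinarith
      _ ≤ Y * (2 * harmonic (N ^ 2) * (8 * (j + 1).factorial * Y * Q)) :=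
          h1.trans (by gcongr)
      _ ≤ Y * (2 * Y * (8 * (j + 1).factorial * Y * Q)) := by gcongr
      _ = _ := by ring
  have hterm : ∀ h ∈ Ioc 0 (N ^ 2), (h : ℝ)⁻¹ *
      ‖∑ n ∈ Ioc N (2 * N), expTwoPi (h * ((n : ℝ) ^ (j + 1) * α))‖ ^ 2 ^ j
      ≤ 2 ^ 2 ^ j * (N : ℝ) ^ (2 ^ j - j - 1) * (j * (N : ℝ) ^ j * (h : ℝ)⁻¹ +
        Y ^ j * ((h : ℝ)⁻¹ * ∑ m ∈ Ioc 0 M, invDist N (m * (h * α)))) := by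
    intro h _
    have h1 := norm_sum_expTwoPi_mul_pow_le hN j (h * α)
    have h2 := weylSum_le hN hY j (fun l hl => hdiv l (Ioc_subset_Ioc_right hN2pos hl)) (h * α)
    have h3 : ∀ n : ℕ, (h : ℝ) * ((n : ℝ) ^ (j + 1) * α) = h * α * (n : ℝ) ^ (j + 1) := by
      intro n
      ring
    simp_rw [h3]
    calc _ ≤ (h : ℝ)⁻¹ * (2 ^ 2 ^ j * (N : ℝ) ^ (2 ^ j - j - 1) * (j * (N : ℝ) ^ j
          + Y ^ j * ∑ m ∈ Ioc 0 M, invDist N (m * (h * α)))) := by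
          gcongr
          exact h1.trans (by gcongr)
      _ = _ := by ring
  refine (sum_le_sum hterm).trans ?_
  rw [← mul_sum, sum_add_distrib, ← mul_sum, ← mul_sum, ← cast_harmonic_eq_sum_Ioc]
  have hQj : (N : ℝ) ^ j ≤ Q := by
    have : 0 ≤ (N : ℝ) ^ (j + 1) * α := by positivity
    have : 0 < α⁻¹ := by positivity
    linarith
  have hYj : Y ≤ Y ^ (j + 3) := le_self_pow₀ hY (by lia)
  calc 2 ^ 2 ^ j * (N : ℝ) ^ (2 ^ j - j - 1) * (j * (N : ℝ) ^ j * harmonic (N ^ 2) +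
        Y ^ j * ∑ h ∈ Ioc 0 (N ^ 2), (h : ℝ)⁻¹ * ∑ m ∈ Ioc 0 M, invDist N (m * (h * α)))
      ≤ 2 ^ 2 ^ j * (N : ℝ) ^ (2 ^ j - j - 1) * (j * Q * Y ^ (j + 3) +
        Y ^ j * (16 * (j + 1).factorial * Y ^ 3 * Q)) := by
        gcongr
        exact hN2.trans hYj
    _ = _ := by ring

theorem add_add_rpow_le {a b c θ : ℝ} (ha : 0 ≤ a) (hb : 0 ≤ b) (hc : 0 ≤ c) (hθ : 0 ≤ θ)
    (hθ1 : θ ≤ 1) : (a + b + c) ^ θ ≤ a ^ θ + b ^ θ + c ^ θ :=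
  (Real.rpow_add_le_add_rpow (by positivity) hc hθ hθ1).trans
    (add_le_add_left (Real.rpow_add_le_add_rpow ha hb hθ hθ1) _)

theorem sum_inv_mul_norm_sum_expTwoPi_le {N j : ℕ} (hN : 1 ≤ N) (hj : 1 ≤ j) {α Y θ : ℝ}
    (hα : 0 < α) (hY : 1 ≤ Y)
    (hdiv : ∀ l ∈ Ioc 0 (N ^ 2 * ((j + 1).factorial * N ^ j)), (#l.divisors : ℝ) ≤ Y)
    (hN2 : (harmonic (N ^ 2) : ℝ) ≤ Y) (hα2 : (harmonic ⌊α⁻¹⌋₊ : ℝ) ≤ Y)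
    (hθ : θ = ((2 : ℝ) ^ j)⁻¹) :
    ∑ h ∈ Ioc 0 (N ^ 2), (h : ℝ)⁻¹ *
        ‖∑ n ∈ Ioc N (2 * N), expTwoPi (h * ((n : ℝ) ^ (j + 1) * α))‖
      ≤ 2 ^ 2 ^ j * (j + 16 * (j + 1).factorial) * Y ^ (j + 4) *
        (N * α ^ θ + (N : ℝ) ^ (1 - θ) + (N : ℝ) ^ (1 - (j + 1) * θ) * α ^ (-θ)) := by
  have hN0 : (0 : ℝ) < N := by exact_mod_cast hN
  have hK1 : (1 : ℝ) ≤ 2 ^ j := one_le_pow₀ (by norm_num)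
  have hθ0 : 0 < θ := by rw [hθ]; positivity
  have hθ1 : θ ≤ 1 := by rw [hθ]; exact inv_le_one_of_one_le₀ hK1
  have hKθ : (2 : ℝ) ^ j * θ = 1 := by rw [hθ]; field_simp
  set c : ℝ := 2 ^ 2 ^ j * (j + 16 * (j + 1).factorial) with hc
  have hfac : (1 : ℝ) ≤ (j + 1).factorial := by exact_mod_cast Nat.factorial_pos _
  have hc1 : 1 ≤ c := by
    rw [hc]
    refine one_le_mul_of_one_le_of_one_le (one_le_pow₀ (by norm_num)) ?_
    have : (0 : ℝ) ≤ j := Nat.cast_nonneg _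
    linarith
  have hmain := sum_inv_mul_norm_sum_expTwoPi_pow_le hN hj hα hY hdiv hN2 hα2
  have hholder := Real.inner_le_weight_mul_Lp_of_nonneg (Ioc 0 (N ^ 2)) hK1
    (fun h : ℕ => (h : ℝ)⁻¹)
    (fun h : ℕ => ‖∑ n ∈ Ioc N (2 * N), expTwoPi (h * ((n : ℝ) ^ (j + 1) * α))‖)
    (fun _ => by positivity) (fun _ => norm_nonneg _)
  rw [← cast_harmonic_eq_sum_Ioc, ← hθ] at hholder
  have hcast : ∀ x : ℝ, x ^ ((2 : ℝ) ^ j) = x ^ 2 ^ j := by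
    intro x
    exact_mod_cast Real.rpow_natCast x (2 ^ j)
  simp_rw [hcast] at hholder
  have hharm := cast_harmonic_nonneg (N ^ 2)
  have hjK : j + 1 ≤ 2 ^ j := Nat.lt_two_pow_self
  have hroot : ((N : ℝ) ^ (2 ^ j - j - 1) * ((N : ℝ) ^ (j + 1) * α + (N : ℝ) ^ j + α⁻¹)) ^ θ
      ≤ N * α ^ θ + (N : ℝ) ^ (1 - θ) + (N : ℝ) ^ (1 - (j + 1) * θ) * α ^ (-θ) := by
    rw [mul_add, mul_add, ← mul_assoc, ← pow_add, ← pow_add]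
    refine (add_add_rpow_le (by positivity) (by positivity) (by positivity) hθ0.le hθ1).trans ?_
    have hpow : ∀ e : ℕ, ((N : ℝ) ^ e) ^ θ = (N : ℝ) ^ (e * θ) := by
      intro e
      rw [Real.rpow_mul hN0.le, Real.rpow_natCast]
    rw [Real.mul_rpow (by positivity) hα.le, Real.mul_rpow (by positivity) (by positivity),
      Real.inv_rpow hα.le, ← Real.rpow_neg hα.le, hpow, hpow, hpow]
    have e1 : ((2 ^ j - j - 1 + (j + 1) : ℕ) : ℝ) * θ = 1 := by
      rw [show 2 ^ j - j - 1 + (j + 1) = 2 ^ j by lia]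
      push_cast
      exact hKθ
    have e2 : ((2 ^ j - j - 1 + j : ℕ) : ℝ) * θ = 1 - θ := by
      push_cast at e1 ⊢
      linarith
    have e3 : ((2 ^ j - j - 1 : ℕ) : ℝ) * θ = 1 - (j + 1) * θ := by
      push_cast at e1 ⊢
      linarith
    rw [e1, e2, e3, Real.rpow_one]
  refine hholder.trans ?_
  set R : ℝ := (N : ℝ) ^ (2 ^ j - j - 1) * ((N : ℝ) ^ (j + 1) * α + (N : ℝ) ^ j + α⁻¹) with hR
  have hR0 : 0 ≤ R := by positivity
  have hcY : 1 ≤ c * Y ^ (j + 3) := one_le_mul_of_one_le_of_one_le hc1 (one_le_pow₀ hY)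
  calc (harmonic (N ^ 2) : ℝ) ^ (1 - θ) * (∑ h ∈ Ioc 0 (N ^ 2), (h : ℝ)⁻¹ *
        ‖∑ n ∈ Ioc N (2 * N), expTwoPi (h * ((n : ℝ) ^ (j + 1) * α))‖ ^ 2 ^ j) ^ θ
      ≤ Y ^ (1 - θ) * (c * Y ^ (j + 3) * R) ^ θ := by gcongr
    _ ≤ Y * (c * Y ^ (j + 3) * R ^ θ) := by
        rw [Real.mul_rpow (by positivity) hR0]
        gcongr
        · exact Real.rpow_le_self_of_one_le hY (by linarith)
        · exact Real.rpow_le_self_of_one_le hcY hθ1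
    _ = c * Y ^ (j + 4) * R ^ θ := by ring
    _ ≤ _ := by gcongr

theorem harmonic_le_mul_rpow {η X : ℝ} (hη : 0 < η) (hX : 1 ≤ X) {n : ℕ} (hn : (n : ℝ) ≤ X ^ 2) :
    (harmonic n : ℝ) ≤ (1 + 2 / η) * X ^ η := by
  have h1 := Real.log_le_rpow_div (Nat.cast_nonneg (α := ℝ) n) (half_pos hη)
  have h2 : (n : ℝ) ^ (η / 2) ≤ X ^ η := by
    calc (n : ℝ) ^ (η / 2) ≤ (X ^ 2) ^ (η / 2) := by gcongr
      _ = X ^ η := by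
        rw [← Real.rpow_natCast, ← Real.rpow_mul (by linarith)]
        congr 1
        push_cast
        ring
  have h3 : 1 ≤ X ^ η := Real.one_le_rpow hX hη.le
  calc (harmonic n : ℝ) ≤ 1 + Real.log n := harmonic_le_one_add_log n
    _ ≤ X ^ η + X ^ η / (η / 2) := by
        refine add_le_add h3 (h1.trans ?_)
        gcongr
    _ = _ := by field_simp

theorem abs_psi_le_one (x : ℝ) : |psi x| ≤ 1 := by
  rw [psi_eq_fract, abs_le]
  have h0 := Int.fract_nonneg x
  have h1 := Int.fract_lt_one x
  constructor <;> linarith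

theorem sum_psi_pow_le (k : ℕ) (hk : 2 ≤ k) (ε : ℝ) (hε : 0 < ε) :
    ∃ C : ℝ, 0 < C ∧ ∀ (N : ℕ) (α : ℝ), 1 ≤ N → 0 < α →
      |∑ n ∈ Finset.Ioc N (2 * N), psi ((n : ℝ) ^ k * α)|
        ≤ C * ((N : ℝ) * max α (1/α)) ^ ε *
            ((N : ℝ) * α ^ ((2 : ℝ) ^ (1 - (k : ℝ)))
              + (N : ℝ) ^ (1 - (2 : ℝ) ^ (1 - (k : ℝ)))
              + (N : ℝ) ^ (1 - (k : ℝ) * (2 : ℝ) ^ (1 - (k : ℝ)))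
                  * α ^ (-(2 : ℝ) ^ (1 - (k : ℝ)))) := by
  obtain ⟨j, rfl⟩ : ∃ j, k = j + 1 := ⟨k - 1, by lia⟩
  have hj : 1 ≤ j := by lia
  set θ : ℝ := (2 : ℝ) ^ (1 - ((j + 1 : ℕ) : ℝ)) with hθdef
  have hθ : θ = ((2 : ℝ) ^ j)⁻¹ := by
    rw [hθdef, ← Real.rpow_natCast, ← Real.rpow_neg (by norm_num)]
    congr 1
    push_cast
    ring
  have hθ0 : 0 < θ := by positivity
  have hθ1 : θ ≤ 1 := by
    rw [hθ]
    exact inv_le_one_of_one_le₀ (one_le_pow₀ (by norm_num))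
  set η : ℝ := ε / (j + 4) with hη
  have hη0 : 0 < η := by positivity
  obtain ⟨D, hD1, hD⟩ := exists_card_divisors_le_mul_rpow (η := η / (j + 2)) (by positivity)
  set A : ℝ := D * ((j + 1).factorial : ℝ) ^ (η / (j + 2)) + (1 + 2 / η) with hA
  have hA1 : 1 ≤ A := by
    have h1 : 0 ≤ D * ((j + 1).factorial : ℝ) ^ (η / (j + 2)) := by positivity
    have h2 : 0 ≤ 2 / η := by positivity
    linarith
  set c : ℝ := 2 ^ 2 ^ j * (j + 16 * (j + 1).factorial) with hc
  have hc0 : 0 ≤ c := by positivity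
  have hAj : 1 ≤ A ^ (j + 4) := one_le_pow₀ hA1
  refine ⟨(1 + c) * A ^ (j + 4), by positivity, fun N α hN hα => ?_⟩
  have hN0 : (0 : ℝ) < N := by exact_mod_cast hN
  have hN1 : (1 : ℝ) ≤ N := by exact_mod_cast hN
  set X : ℝ := N * max α (1 / α) with hX
  have hmax : 1 ≤ max α (1 / α) := by
    rcases le_total 1 α with h | h
    · exact h.trans (le_max_left _ _)
    · exact (one_le_one_div hα h).trans (le_max_right _ _)
  have hNX : (N : ℝ) ≤ X := le_mul_of_one_le_right hN0.le hmax
  have hX1 : 1 ≤ X := hN1.trans hNX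
  have hcard : #(Ioc N (2 * N)) = N := by
    rw [Nat.card_Ioc]
    lia
  rcases le_total 1 α with h1α | hα1
  · calc |∑ n ∈ Ioc N (2 * N), psi ((n : ℝ) ^ (j + 1) * α)|
        ≤ ∑ n ∈ Ioc N (2 * N), |psi ((n : ℝ) ^ (j + 1) * α)| := abs_sum_le_sum_abs _ _
      _ ≤ ∑ n ∈ Ioc N (2 * N), (1 : ℝ) := sum_le_sum fun n _ => abs_psi_le_one _
      _ = 1 * (N * 1 + 0 + 0) := by simp [hcard]
      _ ≤ (1 + c) * A ^ (j + 4) * X ^ ε * _ := by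
          gcongr
          · refine one_le_mul_of_one_le_of_one_le
              (one_le_mul_of_one_le_of_one_le (by linarith) hAj) (Real.one_le_rpow hX1 hε.le)
          · exact Real.one_le_rpow h1α hθ0.le
          · positivity
          · positivity
  · have hXη : 1 ≤ X ^ η := Real.one_le_rpow hX1 hη0.le
    set Y : ℝ := A * X ^ η with hY
    have hY1 : 1 ≤ Y := one_le_mul_of_one_le_of_one_le hA1 hXη
    have hdiv : ∀ l ∈ Ioc 0 (N ^ 2 * ((j + 1).factorial * N ^ j)), (#l.divisors : ℝ) ≤ Y := by
      intro l hl
      obtain ⟨hl0, hl1⟩ := mem_Ioc.mp hl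
      have hl2 : (l : ℝ) ≤ (j + 1).factorial * X ^ (j + 2) := by
        calc (l : ℝ) ≤ ((N ^ 2 * ((j + 1).factorial * N ^ j) : ℕ) : ℝ) := by exact_mod_cast hl1
          _ = (j + 1).factorial * (N : ℝ) ^ (j + 2) := by
              push_cast
              ring
          _ ≤ _ := by gcongr
      calc (#l.divisors : ℝ) ≤ D * (l : ℝ) ^ (η / (j + 2)) := hD l hl0.ne'
        _ ≤ D * ((j + 1).factorial * X ^ (j + 2)) ^ (η / (j + 2)) := by gcongr
        _ = D * ((j + 1).factorial : ℝ) ^ (η / (j + 2)) * X ^ η := by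
            rw [Real.mul_rpow (by positivity) (by positivity), ← Real.rpow_natCast X,
              ← Real.rpow_mul (by linarith), mul_assoc]
            congr 3
            push_cast
            field_simp
        _ ≤ A * X ^ η := by
            gcongr
            have : 0 ≤ 2 / η := by positivity
            linarith
    have hharm : ∀ n : ℕ, (n : ℝ) ≤ X ^ 2 → (harmonic n : ℝ) ≤ Y := by
      intro n hn
      refine (harmonic_le_mul_rpow hη0 hX1 hn).trans ?_
      rw [hY]
      gcongr
      rw [hA, le_add_iff_nonneg_left]
      positivity
    have hN2 : (harmonic (N ^ 2) : ℝ) ≤ Y := by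
      refine hharm _ ?_
      push_cast
      gcongr
    have hα2 : (harmonic ⌊α⁻¹⌋₊ : ℝ) ≤ Y := by
      refine hharm _ ((Nat.floor_le (by positivity)).trans ?_)
      have h1 : α⁻¹ ≤ max α (1 / α) := by
        rw [← one_div]
        exact le_max_right _ _
      calc α⁻¹ ≤ X := h1.trans (le_mul_of_one_le_left (by positivity) hN1)
        _ ≤ X ^ 2 := le_self_pow₀ hX1 (by norm_num)
    have hψ := abs_sum_psi_le hN hcard.le fun n => (n : ℝ) ^ (j + 1) * α
    have hT := sum_inv_mul_norm_sum_expTwoPi_le hN hj hα hY1 hdiv hN2 hα2 hθ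
    have hYpow : Y ^ (j + 4) = A ^ (j + 4) * X ^ ε := by
      rw [hY, mul_pow, ← Real.rpow_natCast (X ^ η), ← Real.rpow_mul (by linarith)]
      congr 2
      push_cast
      rw [hη]
      field_simp
    push_cast
    set R : ℝ := N * α ^ θ + (N : ℝ) ^ (1 - θ) + (N : ℝ) ^ (1 - ((j : ℝ) + 1) * θ) * α ^ (-θ)
      with hR
    have hR1 : 1 ≤ R := by
      have h1 : 1 ≤ (N : ℝ) ^ (1 - θ) := Real.one_le_rpow hN1 (by linarith)
      have h2 : 0 ≤ N * α ^ θ := by positivity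
      have h3 : 0 ≤ (N : ℝ) ^ (1 - ((j : ℝ) + 1) * θ) * α ^ (-θ) := by positivity
      linarith
    calc |∑ n ∈ Ioc N (2 * N), psi ((n : ℝ) ^ (j + 1) * α)|
        ≤ 1 + c * Y ^ (j + 4) * R := hψ.trans (by gcongr)
      _ ≤ Y ^ (j + 4) * R + c * Y ^ (j + 4) * R := by
          gcongr
          exact one_le_mul_of_one_le_of_one_le (one_le_pow₀ hY1) hR1
      _ = _ := by
          rw [hYpow]
          ring
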